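/- arXiv:1405.0260 — 4 statements merged into one kernel-verified Lean document; each statement's English description precedes it below -/
import Mathlib

section
/- Let V₁ ⊆ V be a closed subspace with Galerkin projection P₁ : V → V₁, let (λ, u) be an eigenpair, let (λ⁰, u⁰) ∈ ℝ × V with ‖u⁰‖₀ = 1, and let u^{1/2} ∈ V₁ satisfy a(u^{1/2}, v) = λ⁰⟨u⁰, v⟩₀ for all v ∈ V₁. Then ‖P₁u − u^{1/2}‖₁ ≤ (c₀/α)·(|λ|·‖u − u⁰‖₀ + |λ − λ⁰|). -/
open scoped RealInnerProductSpace

/-- `‖P₁u − u^{1/2}‖₁ ≤ (c₀/α)(|λ|‖u − u⁰‖₀ + |λ − λ⁰|)`. -/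
theorem galerkin_minus_half_bound
    {V H : Type*}
    [NormedAddCommGroup V] [InnerProductSpace ℝ V] [CompleteSpace V]
    [NormedAddCommGroup H] [InnerProductSpace ℝ H] [CompleteSpace H]
    (ι : V →L[ℝ] H) (hι : Function.Injective ι)
    (c₀ : ℝ) (hc₀ : ∀ v : V, ‖ι v‖ ≤ c₀ * ‖v‖)
    (a : V →ₗ[ℝ] V →ₗ[ℝ] ℝ)
    (hsymm : ∀ u v : V, a u v = a v u)
    (M : ℝ) (hbdd : ∀ u v : V, |a u v| ≤ M * ‖u‖ * ‖v‖)
    (α : ℝ) (hα : 0 < α) (hcoer : ∀ v : V, α * ‖v‖ ^ 2 ≤ a v v)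
    (V₁ : Submodule ℝ V) (hV₁ : IsClosed (V₁ : Set V))
    (P₁ : V → V)
    (hP₁mem : ∀ u : V, P₁ u ∈ V₁)
    (hP₁ : ∀ u : V, ∀ v ∈ V₁, a (u - P₁ u) v = 0)
    (lam : ℝ) (u : V) (hu : ‖ι u‖ = 1)
    (heig : ∀ v : V, a u v = lam * ⟪ι u, ι v⟫)
    (lam0 : ℝ) (u0 : V) (hu0 : ‖ι u0‖ = 1)
    (uhalf : V) (hhalfmem : uhalf ∈ V₁)
    (hhalf : ∀ v ∈ V₁, a uhalf v = lam0 * ⟪ι u0, ι v⟫) :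
    ‖P₁ u - uhalf‖ ≤ (c₀ / α) * (|lam| * ‖ι (u - u0)‖ + |lam - lam0|) := by
  obtain ⟨w, hw⟩ : ∃ w, w = P₁ u - uhalf := ⟨_, rfl⟩
  rw [← hw]
  have hwm : w ∈ V₁ := hw ▸ V₁.sub_mem (hP₁mem u) hhalfmem
  have h1 : a w w = ⟪lam • ι (u - u0) + (lam - lam0) • ι u0, ι w⟫ := by
    have e1 := hP₁ u w hwm
    have e2 : a w w = a (P₁ u) w - a uhalf w := by
      rw [← LinearMap.map_sub₂, ← hw]
    rw [LinearMap.map_sub₂] at e1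
    rw [e2, hhalf w hwm, map_sub ι, inner_add_left, real_inner_smul_left, real_inner_smul_left,
      inner_sub_left]
    have e3 := heig w
    linarith
  have hc : 0 ≤ c₀ := by
    by_contra hneg
    have h := hc₀ u
    rw [hu] at h
    have := norm_nonneg u
    nlinarith
  set K := |lam| * ‖ι (u - u0)‖ + |lam - lam0| with hK
  have hK0 : 0 ≤ K := by positivity
  have h2 : ‖lam • ι (u - u0) + (lam - lam0) • ι u0‖ ≤ K := by
    refine (norm_add_le _ _).trans ?_
    rw [norm_smul, norm_smul, hu0, Real.norm_eq_abs, Real.norm_eq_abs, mul_one]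
  have h3 : α * ‖w‖ ^ 2 ≤ K * (c₀ * ‖w‖) := by
    calc α * ‖w‖ ^ 2 ≤ a w w := hcoer w
      _ ≤ _ := h1 ▸ real_inner_le_norm _ _
      _ ≤ K * (c₀ * ‖w‖) := mul_le_mul h2 (hc₀ w) (norm_nonneg _) hK0
  rw [div_mul_eq_mul_div, le_div_iff₀ hα]
  rcases (norm_nonneg w).eq_or_lt with h | h
  · rw [← h, zero_mul]; positivity
  · refine le_of_mul_le_mul_right ?_ h
    linarith
end

section
/- Let V₁ ⊆ V be a closed subspace, let (λ, u) be an eigenpair, let (λ⁰, u⁰) ∈ ℝ × V with ‖u⁰‖₀ = 1, and let u^{1/2} ∈ V₁ satisfy a(u^{1/2}, v) = λ⁰⟨u⁰, v⟩₀ for all v ∈ V₁. Then ‖u − u^{1/2}‖₁ ≤ (M/α)·inf_{v ∈ V₁}‖u − v‖₁ + (c₀/α)·(|λ|·‖u − u⁰‖₀ + |λ − λ⁰|). -/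
open scoped RealInnerProductSpace

/-- `‖u − u^{1/2}‖₁ ≤ (M/α)·inf_{v ∈ V₁}‖u − v‖₁ + (c₀/α)(|λ|‖u − u⁰‖₀ + |λ − λ⁰|)`. -/
theorem half_step_error_bound
    {V H : Type*}
    [NormedAddCommGroup V] [InnerProductSpace ℝ V] [CompleteSpace V]
    [NormedAddCommGroup H] [InnerProductSpace ℝ H] [CompleteSpace H]
    (ι : V →L[ℝ] H) (hι : Function.Injective ι)
    (c₀ : ℝ) (hc₀ : ∀ v : V, ‖ι v‖ ≤ c₀ * ‖v‖)
    (a : V →ₗ[ℝ] V →ₗ[ℝ] ℝ)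
    (hsymm : ∀ u v : V, a u v = a v u)
    (M : ℝ) (hbdd : ∀ u v : V, |a u v| ≤ M * ‖u‖ * ‖v‖)
    (α : ℝ) (hα : 0 < α) (hcoer : ∀ v : V, α * ‖v‖ ^ 2 ≤ a v v)
    (V₁ : Submodule ℝ V) (hV₁ : IsClosed (V₁ : Set V))
    (lam : ℝ) (u : V) (hu : ‖ι u‖ = 1)
    (heig : ∀ v : V, a u v = lam * ⟪ι u, ι v⟫)
    (lam0 : ℝ) (u0 : V) (hu0 : ‖ι u0‖ = 1)
    (uhalf : V) (hhalfmem : uhalf ∈ V₁)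
    (hhalf : ∀ v ∈ V₁, a uhalf v = lam0 * ⟪ι u0, ι v⟫) :
    ‖u - uhalf‖ ≤ (M / α) * (⨅ v : V₁, ‖u - (v : V)‖)
      + (c₀ / α) * (|lam| * ‖ι (u - u0)‖ + |lam - lam0|) := by
  have hu1 : 0 < ‖u‖ := by
    rw [norm_pos_iff]
    rintro rfl
    simp at hu
  have hc : 0 ≤ c₀ := by
    by_contra h
    push Not at h
    have := hc₀ u
    rw [hu] at this
    nlinarith
  have hM : 0 ≤ M := by
    by_contra h
    push Not at h
    have h1 := hbdd u u
    have h2 := abs_nonneg (a u u)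
    have h3 : 0 < ‖u‖ * ‖u‖ := by positivity
    nlinarith
  have : CompleteSpace V₁ := hV₁.completeSpace_coe
  -- Galerkin projection
  obtain ⟨w, hw⟩ : ∃ w : V₁, ∀ v : V₁, a (w : V) (v : V) = a u (v : V) := by
    let B : V₁ →L[ℝ] V₁ →L[ℝ] ℝ :=
      LinearMap.mkContinuous₂ (a.domRestrict₁₂ V₁ V₁) M (fun x y => by
        exact hbdd (x : V) (y : V))
    have hB : ∀ x y : V₁, B x y = a (x : V) (y : V) := fun x y => rfl
    have hco : IsCoercive B := ⟨α, hα, fun x => by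
      rw [hB]
      have := hcoer (x : V)
      simp only [Submodule.coe_norm]
      nlinarith⟩
    let f : V₁ →L[ℝ] ℝ := LinearMap.mkContinuous ((a u).comp V₁.subtype) (M * ‖u‖)
      (fun y => by simpa using hbdd u (y : V))
    have hf : ∀ y : V₁, f y = a u (y : V) := fun y => rfl
    refine ⟨hco.continuousLinearEquivOfBilin.symm ((InnerProductSpace.toDual ℝ V₁).symm f), ?_⟩
    intro v
    rw [← hB, ← hco.continuousLinearEquivOfBilin_apply, ContinuousLinearEquiv.apply_symm_apply,
      InnerProductSpace.toDual_symm_apply, hf]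
  have h1 : ‖u - w‖ ≤ (M / α) * (⨅ v : V₁, ‖u - (v : V)‖) := by
    rw [Real.mul_iInf_of_nonneg (by positivity)]
    refine le_ciInf fun v => ?_
    rw [div_mul_eq_mul_div, le_div_iff₀ hα]
    have e : a (u - w) (u - w) = a (u - w) (u - v) := by
      have hz := hw (v - w)
      simp only [Submodule.coe_sub, map_sub, LinearMap.sub_apply] at hz ⊢
      linarith
    have b1 := hcoer (u - w)
    have b2 := (le_abs_self _).trans (hbdd (u - w) (u - v))
    rw [e] at b1
    rcases (norm_nonneg (u - (w : V))).eq_or_lt with h | h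
    · rw [← h]; simp; positivity
    · refine le_of_mul_le_mul_right ?_ h
      nlinarith
  have h2 : ‖(w : V) - uhalf‖ ≤ (c₀ / α) * (|lam| * ‖ι (u - u0)‖ + |lam - lam0|) := by
    rw [div_mul_eq_mul_div, le_div_iff₀ hα]
    set e : V := (w : V) - uhalf with he
    have hem : e ∈ V₁ := V₁.sub_mem w.2 hhalfmem
    have b1 := hcoer e
    have e1 : a e e = lam * ⟪ι (u - u0), ι e⟫ + (lam - lam0) * ⟪ι u0, ι e⟫ := by
      have k1 := hw ⟨e, hem⟩
      have k2 := hhalf e hem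
      have k3 := heig e
      have k4 : a e e = a (w : V) e - a uhalf e := by
        rw [← LinearMap.sub_apply, ← map_sub]
      simp only at k1
      rw [k4, k1, k2, k3, map_sub ι u u0, inner_sub_left]
      ring
    have i1 : lam * ⟪ι (u - u0), ι e⟫ ≤ |lam| * (‖ι (u - u0)‖ * ‖ι e‖) := by
      refine (le_abs_self _).trans ?_
      rw [abs_mul]
      exact mul_le_mul_of_nonneg_left (abs_real_inner_le_norm _ _) (abs_nonneg _)
    have i2 : (lam - lam0) * ⟪ι u0, ι e⟫ ≤ |lam - lam0| * ‖ι e‖ := by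
      refine (le_abs_self _).trans ?_
      rw [abs_mul]
      refine mul_le_mul_of_nonneg_left ?_ (abs_nonneg _)
      simpa [hu0] using abs_real_inner_le_norm (ι u0) (ι e)
    have i3 : (|lam| * ‖ι (u - u0)‖ + |lam - lam0|) * ‖ι e‖
        ≤ (|lam| * ‖ι (u - u0)‖ + |lam - lam0|) * (c₀ * ‖e‖) :=
      mul_le_mul_of_nonneg_left (hc₀ e) (by positivity)
    rcases (norm_nonneg e).eq_or_lt with h | h
    · rw [← h]; simp only [zero_mul]; positivity
    · refine le_of_mul_le_mul_right ?_ h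
      nlinarith
  calc ‖u - uhalf‖ = ‖(u - w) + (w - uhalf)‖ := by congr 1; abel
    _ ≤ ‖u - w‖ + ‖(w : V) - uhalf‖ := norm_add_le _ _
    _ ≤ _ := add_le_add h1 h2
end

section
/- (Theorem A.1, one-iteration error estimate for the parallel orbital-updating algorithm.) Let (λ₁, u₁), …, (λ_N, u_N) be eigenpairs, let (λ_k^{(0)}, u_k^{(0)}) ∈ ℝ × V with ‖u_k^{(0)}‖₀ = 1 for k = 1, …, N, let V₁ ⊆ V be a closed subspace, and for each k let u_k^{(1/2)} ∈ V₁ be the unique solution of a(u_k^{(1/2)}, v) = λ_k^{(0)}⟨u_k^{(0)}, v⟩₀ for all v ∈ V₁. Let A ≥ 0 and let Λ ≥ max_{1 ≤ k ≤ N}|λ_k|. Then there exists a constant C, depending only on M, α, c₀, A and Λ (and not on V₁, N, the eigenpairs or the initial data), such that for every u^{(1)} = Σ_{k=1}^N α_k u_k^{(1/2)} with |α_k| ≤ A for all k, one has d₁(u^{(1)}, W) ≤ C · Σ_{k=1}^N ( |λ_k − λ_k^{(0)}| + inf_{v ∈ V₁}‖u_k − v‖₁ + ‖u_k − u_k^{(0)}‖₀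 ), where W = span{u₁, …, u_N} and d₁(w, W) = inf_{v ∈ W}‖w − v‖₁. -/
open scoped RealInnerProductSpace

theorem pou_aux {V H : Type*}
    [NormedAddCommGroup V] [InnerProductSpace ℝ V]
    [NormedAddCommGroup H] [InnerProductSpace ℝ H]
    (ι : V →L[ℝ] H)
    (c₀ : ℝ) (hc₀ : ∀ v : V, ‖ι v‖ ≤ c₀ * ‖v‖)
    (a : V →ₗ[ℝ] V →ₗ[ℝ] ℝ)
    (M : ℝ) (hbdd : ∀ u v : V, |a u v| ≤ M * ‖u‖ * ‖v‖)
    (α : ℝ) (hα : 0 < α) (hcoer : ∀ v : V, α * ‖v‖ ^ 2 ≤ a v v) (Λ : ℝ)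
    (V₁ : Submodule ℝ V) (l l0 : ℝ) (u u0 uh : V)
    (hu : ∀ v : V, a u v = l * ⟪ι u, ι v⟫) (hl : |l| ≤ Λ) (hu0 : ‖ι u0‖ = 1)
    (huh : uh ∈ V₁) (hh : ∀ v ∈ V₁, a uh v = l0 * ⟪ι u0, ι v⟫) :
    ‖uh - u‖ ≤ ((|c₀| * (1 + |Λ|) + |M|) / α + 1) *
      (|l - l0| + (⨅ v : V₁, ‖u - (v : V)‖) + ‖ι (u - u0)‖) := by
  set B := |c₀| * (1 + |Λ|) + |M| with hB
  have hB0 : 0 ≤ B := by positivity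
  have hK : 0 < B / α + 1 := by positivity
  have key : ∀ v : V₁, ‖uh - u‖ ≤ (B / α + 1) * (|l - l0| + ‖u - (v : V)‖ + ‖ι (u - u0)‖) := by
    intro v
    set w := uh - (v : V) with hw
    have hwV : w ∈ V₁ := V₁.sub_mem huh v.2
    set S := |l - l0| + ‖u - (v : V)‖ + ‖ι (u - u0)‖ with hS
    have e1 : a w w = (l0 - l) * ⟪ι u0, ι w⟫ - l * ⟪ι (u - u0), ι w⟫ + a (u - v) w := by
      have : a w w = a uh w - a u w + a (u - v) w := by
        conv_lhs => rw [show a w = a (uh - v) from rfl]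
        simp only [map_sub, LinearMap.sub_apply]; ring
      rw [this, hh w hwV, hu w, map_sub ι u u0, inner_sub_left]; ring
    have hcw : ‖ι w‖ ≤ |c₀| * ‖w‖ := (hc₀ w).trans (by gcongr; exact le_abs_self _)
    have hlL : |l| ≤ |Λ| := hl.trans (le_abs_self _)
    have b1 : (l0 - l) * ⟪ι u0, ι w⟫ ≤ |l - l0| * (|c₀| * ‖w‖) := by
      refine (le_abs_self _).trans ?_
      rw [abs_mul, abs_sub_comm]
      gcongr
      refine (abs_real_inner_le_norm _ _).trans ?_
      rw [hu0, one_mul]; exact hcw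
    have b2 : - (l * ⟪ι (u - u0), ι w⟫) ≤ |Λ| * (‖ι (u - u0)‖ * (|c₀| * ‖w‖)) := by
      refine (neg_le_abs _).trans ?_
      rw [abs_mul]
      gcongr
      refine (abs_real_inner_le_norm _ _).trans ?_
      gcongr
    have b3 : a (u - v) w ≤ |M| * ‖u - (v : V)‖ * ‖w‖ := by
      refine (le_abs_self _).trans ((hbdd _ _).trans ?_)
      gcongr; exact le_abs_self _
    have b4 : α * ‖w‖ ^ 2 ≤ B * S * ‖w‖ := by
      have h1 : |c₀| * |l - l0| + |Λ| * |c₀| * ‖ι (u - u0)‖ + |M| * ‖u - (v : V)‖ ≤ B * S := by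
        have e : B * S = (|c₀| * |l - l0| + |Λ| * |c₀| * ‖ι (u - u0)‖ + |M| * ‖u - (v : V)‖)
          + (|c₀| * |Λ| * |l - l0| + |M| * |l - l0| + |c₀| * ‖ι (u - u0)‖ + |M| * ‖ι (u - u0)‖
            + |c₀| * ‖u - (v : V)‖ + |c₀| * |Λ| * ‖u - (v : V)‖) := by rw [hB, hS]; ring
        rw [e]
        exact le_add_of_nonneg_right (by positivity)
      have h2 := mul_le_mul_of_nonneg_right h1 (norm_nonneg w)
      have h3 := hcoer w
      linarith
    have b5 : ‖w‖ ≤ B / α * S := by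
      have hS0 : 0 ≤ S := by positivity
      rcases (norm_nonneg w).eq_or_lt with h | h
      · rw [← h]; positivity
      · have : α * ‖w‖ ≤ B * S := le_of_mul_le_mul_right (by linarith [b4, sq (‖w‖)]) h
        rw [div_mul_eq_mul_div, le_div_iff₀ hα]; linarith
    have b6 : ‖uh - u‖ ≤ ‖w‖ + ‖u - (v : V)‖ := by
      have : uh - u = w - (u - v) := by rw [hw]; abel
      rw [this]; exact norm_sub_le _ _
    have b7 : ‖u - (v : V)‖ ≤ S := by
      have := abs_nonneg (l - l0)
      have := norm_nonneg (ι (u - u0))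
      linarith
    linarith
  have h : ‖uh - u‖ / (B / α + 1) - |l - l0| - ‖ι (u - u0)‖ ≤ ⨅ v : V₁, ‖u - (v : V)‖ := by
    refine le_ciInf fun v => ?_
    have := (div_le_iff₀' hK).2 (key v)
    linarith
  rw [← div_le_iff₀' hK]
  linarith

/-- Theorem A.1: one-iteration error estimate for the parallel
orbital-updating algorithm.  There is a constant `C`, depending only on `M, α, c₀, A, Λ`
(and not on the subspace `V₁`, on `N`, on the eigenpairs or on the initial data), such
that any combination `u^{(1)} = Σ αₖ u_k^{(1/2)}` with `|αₖ| ≤ A` satisfies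
`d₁(u^{(1)}, span{u₁,…,u_N}) ≤ C Σₖ (|λₖ − λₖ⁰| + inf_{v∈V₁}‖uₖ − v‖₁ + ‖uₖ − uₖ⁰‖₀)`. -/
theorem parallel_orbital_updating_one_iteration_estimate
    {V H : Type*}
    [NormedAddCommGroup V] [InnerProductSpace ℝ V] [CompleteSpace V]
    [NormedAddCommGroup H] [InnerProductSpace ℝ H] [CompleteSpace H]
    (ι : V →L[ℝ] H) (hι : Function.Injective ι)
    (c₀ : ℝ) (hc₀ : ∀ v : V, ‖ι v‖ ≤ c₀ * ‖v‖)
    (a : V →ₗ[ℝ] V →ₗ[ℝ] ℝ)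
    (hsymm : ∀ u v : V, a u v = a v u)
    (M : ℝ) (hbdd : ∀ u v : V, |a u v| ≤ M * ‖u‖ * ‖v‖)
    (α : ℝ) (hα : 0 < α) (hcoer : ∀ v : V, α * ‖v‖ ^ 2 ≤ a v v)
    (A : ℝ) (hA : 0 ≤ A) (Λ : ℝ) :
    ∃ C : ℝ, ∀ (V₁ : Submodule ℝ V), IsClosed (V₁ : Set V) →
      ∀ (N : ℕ) (lams : Fin N → ℝ) (us : Fin N → V),
        (∀ k, ‖ι (us k)‖ = 1) →
        (∀ k, ∀ v : V, a (us k) v = lams k * ⟪ι (us k), ι v⟫) →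
        (∀ k, |lams k| ≤ Λ) →
        ∀ (lam0 : Fin N → ℝ) (u0 : Fin N → V),
          (∀ k, ‖ι (u0 k)‖ = 1) →
          ∀ uhalf : Fin N → V,
            (∀ k, uhalf k ∈ V₁) →
            (∀ k, ∀ v ∈ V₁, a (uhalf k) v = lam0 k * ⟪ι (u0 k), ι v⟫) →
            ∀ coeff : Fin N → ℝ, (∀ k, |coeff k| ≤ A) →
              (⨅ w : Submodule.span ℝ (Set.range us),
                  ‖(∑ k, coeff k • uhalf k) - (w : V)‖)
                ≤ C * ∑ k, (|lams k - lam0 k|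
                    + (⨅ v : V₁, ‖us k - (v : V)‖)
                    + ‖ι (us k - u0 k)‖) := by
  refine ⟨A * ((|c₀| * (1 + |Λ|) + |M|) / α + 1), ?_⟩
  intro V₁ _ N lams us _ hus hL lam0 u0 hu0 uhalf hmem hhalf coeff hcoeff
  have hw : (∑ k, coeff k • us k) ∈ Submodule.span ℝ (Set.range us) :=
    Submodule.sum_mem _ fun k _ => Submodule.smul_mem _ _ (Submodule.subset_span ⟨k, rfl⟩)
  refine (ciInf_le ⟨0, ?_⟩ (⟨_, hw⟩ : Submodule.span ℝ (Set.range us))).trans ?_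
  · rintro _ ⟨w, rfl⟩
    exact norm_nonneg _
  · simp only
    rw [← Finset.sum_sub_distrib, Finset.mul_sum]
    refine norm_sum_le_of_le _ fun k _ => ?_
    rw [← smul_sub, norm_smul, Real.norm_eq_abs, mul_assoc]
    exact mul_le_mul (hcoeff k) (pou_aux ι c₀ hc₀ a M hbdd α hα hcoer Λ V₁ _ _ _ _ _ (hus k)
      (hL k) (hu0 k) (hmem k) (hhalf k)) (norm_nonneg _) hA
end

section
/- Assume in addition that ι : V → H is a compact operator with dense range and that V is infinite-dimensional. Then there exist a nondecreasing sequence of real numbers 0 < λ₁ ≤ λ₂ ≤ λ₃ ≤ ⋯ with λ_i → ∞ and elements u₁, u₂, u₃, ⋯ ∈ V such that ⟨u_i, u_j⟩₀ = δ_{ij} for all i, j, each (λ_i, u_i) is an eigenpair (i.e. a(u_i, v) = λ_i⟨u_i, v⟩₀ for all v ∈ V), and the closed linear span of {ι u_i : i ∈ ℕ} is all of H. -/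
open scoped RealInnerProductSpace


open Module.End in
theorem aux_finite {H I : Type*} [NormedAddCommGroup H] [InnerProductSpace ℝ H]
    (T : H →L[ℝ] H) (hT : IsCompactOperator T) (e : I → H) (he : Orthonormal ℝ e) (μ : I → ℝ)
    (hμ : ∀ i, T (e i) = μ i • e i) (ε : ℝ) (hε : 0 < ε) : {i | ε ≤ μ i}.Finite := by
  by_contra hinf
  have hinf : {i | ε ≤ μ i}.Infinite := hinf
  let f := hinf.natEmbedding
  obtain ⟨K, hK, hsub⟩ := hT.image_closedBall_subset_compact (f := (T : H →ₗ[ℝ] H)) 1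
  have hmem : ∀ n, T (e (f n)) ∈ K := fun n => hsub ⟨e (f n), by simp [he.1], rfl⟩
  obtain ⟨x, -, φ, hφ, hlim⟩ := hK.tendsto_subseq hmem
  have hc := hlim.cauchySeq
  rw [Metric.cauchySeq_iff] at hc
  obtain ⟨N, hN⟩ := hc ε hε
  have h := hN N le_rfl (N+1) (by omega)
  have hne : (f (φ N) : I) ≠ f (φ (N+1)) := by
    intro h
    have := hφ.injective (f.injective (Subtype.ext h))
    omega
  have h1 : ε ≤ μ (f (φ N)) := (f (φ N)).2
  simp only [Function.comp, dist_eq_norm, hμ] at h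
  have h3 := norm_sub_sq_real (μ (f (φ N)) • e (f (φ N))) (μ (f (φ (N+1))) • e (f (φ (N+1))))
  rw [inner_smul_left, inner_smul_right, he.2 hne, norm_smul, norm_smul, he.1, he.1] at h3
  simp only [mul_zero, mul_one, Real.norm_eq_abs, sq_abs, sub_zero] at h3
  nlinarith [norm_nonneg (μ (f (φ N)) • e (f (φ N)) - μ (f (φ (N+1))) • e (f (φ (N+1)))),
    sq_nonneg (μ (f (φ (N+1))))]

theorem aux_order {I : Type*} [Infinite I] (lam : I → ℝ) (h : ∀ C, {i | lam i ≤ C}.Finite) :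
    ∃ σ : ℕ → I, Function.Bijective σ ∧ Monotone (lam ∘ σ) := by
  classical
  have hg : ∀ F : Finset I, ∃ i, i ∉ F ∧ ∀ j, j ∉ F → lam i ≤ lam j := by
    intro F
    obtain ⟨i0, hi0⟩ := Infinite.exists_notMem_finset F
    have hfin : {j | j ∉ F ∧ lam j ≤ lam i0}.Finite := (h (lam i0)).subset fun j hj => hj.2
    obtain ⟨i, hi, hmin⟩ := Set.exists_min_image _ lam hfin ⟨i0, hi0, le_rfl⟩
    refine ⟨i, hi.1, fun j hj => ?_⟩
    rcases le_total (lam j) (lam i0) with h1 | h1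
    · exact hmin j ⟨hj, h1⟩
    · exact hi.2.trans h1
  choose g hg1 hg2 using hg
  let S : ℕ → Finset I := fun n => Nat.rec ∅ (fun _ F => insert (g F) F) n
  have hS : ∀ n, S (n+1) = insert (g (S n)) (S n) := fun n => rfl
  have hmono : Monotone S := monotone_nat_of_le_succ fun n => by
    rw [hS]; exact Finset.subset_insert _ _
  have hmem : ∀ m n, m < n → g (S m) ∈ S n := fun m n hmn =>
    hmono (Nat.succ_le_of_lt hmn) (by rw [Nat.succ_eq_add_one, hS]; exact Finset.mem_insert_self _ _)
  have hinj : Function.Injective fun n => g (S n) := by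
    intro m n hmn
    simp only at hmn
    rcases lt_trichotomy m n with h1 | h1 | h1
    · exact absurd (hmn ▸ hmem m n h1) (hg1 _)
    · exact h1
    · exact absurd (hmn ▸ hmem n m h1) (hg1 _)
  have hin : ∀ n i, i ∈ S n → ∃ m, g (S m) = i := by
    intro n
    induction n with
    | zero => intro i hi; exact absurd hi (Finset.notMem_empty i)
    | succ k ih =>
      intro i hi
      rw [hS, Finset.mem_insert] at hi
      rcases hi with rfl | hi
      · exact ⟨k, rfl⟩
      · exact ih i hi
  refine ⟨fun n => g (S n), ⟨hinj, ?_⟩, ?_⟩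
  · intro i
    by_contra hno
    have hni : ∀ n, i ∉ S n := fun n hi => hno (hin n i hi)
    exact (Set.infinite_range_of_injective hinj) ((h (lam i)).subset (by
      rintro _ ⟨n, rfl⟩
      exact hg2 _ _ (hni n)))
  · intro m n hmn
    exact hg2 _ _ fun hh => hg1 (S n) (hmono hmn hh)

open Module.End in
theorem aux_basis {H : Type*} [NormedAddCommGroup H] [InnerProductSpace ℝ H] [CompleteSpace H]
    (T : H →L[ℝ] H) (hT : IsCompactOperator T) (hs : (T : H →ₗ[ℝ] H).IsSymmetric) :
    ∃ (w : ∀ μ : ℝ, Set (eigenspace (T : Module.End ℝ H) μ)) (e : (Σ μ : ℝ, w μ) → H),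
      Orthonormal ℝ e ∧ (∀ i, T (e i) = i.1 • e i) ∧
      (Submodule.span ℝ (Set.range e)).topologicalClosure = ⊤ := by
  have hclosed : ∀ μ : ℝ, IsClosed (eigenspace (T : Module.End ℝ H) μ : Set H) := by
    intro μ
    have : (eigenspace (T : Module.End ℝ H) μ : Set H) = {x | T x = μ • x} := by
      ext x; simp [mem_eigenspace_iff]
    rw [this]
    exact isClosed_eq T.continuous (continuous_const_smul μ)
  have : ∀ μ : ℝ, CompleteSpace (eigenspace (T : Module.End ℝ H) μ) := fun μ =>
    (hclosed μ).completeSpace_coe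
  choose w b hb using fun μ : ℝ => exists_hilbertBasis ℝ (eigenspace (T : Module.End ℝ H) μ)
  refine ⟨w, fun i => (b i.1 i.2 : H), ?_, ?_, ?_⟩
  · exact hs.orthogonalFamily_eigenspaces.orthonormal_sigma_orthonormal
      (v_family := fun μ => (b μ)) fun μ => (b μ).orthonormal
  · intro i
    exact mem_eigenspace_iff.1 (b i.1 i.2).2
  · rw [Submodule.topologicalClosure_eq_top_iff, eq_bot_iff,
      ← T.orthogonalComplement_iSup_eigenspaces_eq_bot hT hs]
    intro x hx
    rw [← Submodule.iInf_orthogonal, Submodule.mem_iInf]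
    intro μ
    rw [Submodule.mem_orthogonal']
    intro y hy
    have hd := (Submodule.dense_iff_topologicalClosure_eq_top
      (s := Submodule.span ℝ (Set.range (b μ)))).2 (b μ).dense_span
    have : (innerSL ℝ x).comp (eigenspace (T : Module.End ℝ H) μ).subtypeL = 0 := by
      refine ContinuousLinearMap.ext_on hd ?_
      rintro _ ⟨i, rfl⟩
      simp only [ContinuousLinearMap.comp_apply, innerSL_apply_apply, ContinuousLinearMap.zero_apply]
      exact (Submodule.mem_orthogonal' _ _).1 hx _ (Submodule.subset_span ⟨⟨μ, i⟩, rfl⟩)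
    exact congrArg (fun f => f ⟨y, hy⟩) this

/-- if moreover `ι` is a compact operator with dense range and `V` is
infinite-dimensional, then there is a nondecreasing sequence of eigenvalues
`0 < λ₁ ≤ λ₂ ≤ ⋯`, `λ_i → ∞`, with `⟨·,·⟩₀`-orthonormal eigenfunctions whose images
under `ι` span a dense subspace of `H`. -/
theorem eigenvalue_sequence_exists
    {V H : Type*}
    [NormedAddCommGroup V] [InnerProductSpace ℝ V] [CompleteSpace V]
    [NormedAddCommGroup H] [InnerProductSpace ℝ H] [CompleteSpace H]
    (ι : V →L[ℝ] H) (hι : Function.Injective ι)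
    (c₀ : ℝ) (hc₀ : ∀ v : V, ‖ι v‖ ≤ c₀ * ‖v‖)
    (a : V →ₗ[ℝ] V →ₗ[ℝ] ℝ)
    (hsymm : ∀ u v : V, a u v = a v u)
    (M : ℝ) (hbdd : ∀ u v : V, |a u v| ≤ M * ‖u‖ * ‖v‖)
    (α : ℝ) (hα : 0 < α) (hcoer : ∀ v : V, α * ‖v‖ ^ 2 ≤ a v v)
    (hcompact : IsCompactOperator (ι : V →ₗ[ℝ] H))
    (hdense : DenseRange ι)
    (hinf : ¬ FiniteDimensional ℝ V) :
    ∃ (lam : ℕ → ℝ) (u : ℕ → V),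
      Monotone lam ∧
      0 < lam 0 ∧
      Filter.Tendsto lam Filter.atTop Filter.atTop ∧
      (∀ i j, ⟪ι (u i), ι (u j)⟫ = if i = j then 1 else 0) ∧
      (∀ i, ‖ι (u i)‖ = 1) ∧
      (∀ i, ∀ v : V, a (u i) v = lam i * ⟪ι (u i), ι v⟫) ∧
      (Submodule.span ℝ (Set.range fun i => ι (u i))).topologicalClosure = ⊤ := by
  let B : V →L[ℝ] V →L[ℝ] ℝ := LinearMap.mkContinuous₂ a M (fun u v => hbdd u v)
  have hB : ∀ u v, B u v = a u v := fun u v => rfl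
  have hco : IsCoercive B := ⟨α, hα, fun v => by
    rw [hB]; have := hcoer v; nlinarith⟩
  let A := hco.continuousLinearEquivOfBilin
  let R : H →L[ℝ] V := (A.symm : V →L[ℝ] V).comp (ContinuousLinearMap.adjoint ι)
  have hR : ∀ f v, a (R f) v = ⟪f, ι v⟫ := by
    intro f v
    rw [← hB, ← hco.continuousLinearEquivOfBilin_apply, ← ContinuousLinearMap.adjoint_inner_left]
    congr 1
    exact A.apply_symm_apply _
  let T : H →L[ℝ] H := ι.comp R
  have hTR : ∀ f, T f = ι (R f) := fun _ => rfl
  have hT : IsCompactOperator T := hcompact.comp_clm R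
  have hs : (T : H →ₗ[ℝ] H).IsSymmetric := by
    intro f g
    change ⟪T f, g⟫ = ⟪f, T g⟫
    rw [hTR, hTR, real_inner_comm, ← hR, ← hR, hsymm]
  have hpos : ∀ f, f ≠ 0 → 0 < ⟪f, T f⟫ := by
    intro f hf
    rw [hTR, ← hR]
    have hne : R f ≠ 0 := by
      intro h0
      apply hf
      refine hdense.eq_zero_of_inner_left (𝕜 := ℝ) ?_
      intro v
      simp [← hR, h0]
    have := norm_pos_iff.2 hne
    exact lt_of_lt_of_le (by positivity) (hcoer (R f))
  obtain ⟨w, e, he, hTe, hspan⟩ := aux_basis T hT hs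
  have hμpos : ∀ i : Σ μ : ℝ, w μ, 0 < i.1 := by
    intro i
    have h := hpos (e i) (he.ne_zero i)
    rw [hTe, inner_smul_right, real_inner_self_eq_norm_sq, he.1] at h
    simpa using h
  have hfin := aux_finite T hT e he (fun i => i.1) hTe
  have hI : Infinite (Σ μ : ℝ, w μ) := by
    by_contra hni
    rw [not_infinite_iff_finite] at hni
    have : FiniteDimensional ℝ (Submodule.span ℝ (Set.range e)) :=
      FiniteDimensional.span_of_finite ℝ (Set.finite_range e)
    rw [(Submodule.closed_of_finiteDimensional _).submodule_topologicalClosure_eq] at hspan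
    rw [hspan] at this
    have : FiniteDimensional ℝ H := Module.Finite.equiv (Submodule.topEquiv (R := ℝ) (M := H))
    exact hinf (FiniteDimensional.of_injective (ι : V →ₗ[ℝ] H) hι)
  have hfin' : ∀ C : ℝ, {i : Σ μ : ℝ, w μ | i.1⁻¹ ≤ C}.Finite := by
    intro C
    rcases le_or_gt C 0 with hC | hC
    · convert Set.finite_empty
      ext i
      simpa using lt_of_le_of_lt hC (inv_pos.2 (hμpos i))
    · refine (hfin C⁻¹ (inv_pos.2 hC)).subset fun i hi => ?_
      exact inv_le_of_inv_le₀ (hμpos i) hi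
  obtain ⟨σ, hσ, hmono⟩ := aux_order (fun i : Σ μ : ℝ, w μ => i.1⁻¹) hfin'
  have hu : ∀ n, ι ((σ n).1⁻¹ • R (e (σ n))) = e (σ n) := by
    intro n
    rw [map_smul, ← hTR, hTe, smul_smul, inv_mul_cancel₀ (hμpos _).ne', one_smul]
  refine ⟨fun n => (σ n).1⁻¹, fun n => (σ n).1⁻¹ • R (e (σ n)), hmono, inv_pos.2 (hμpos _),
    ?_, ?_, ?_, ?_, ?_⟩
  · rw [Filter.tendsto_atTop]
    intro C
    rw [← Nat.cofinite_eq_atTop]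
    refine ((hfin' C).preimage hσ.1.injOn).subset fun n hn => ?_
    have hn' : ¬ (C ≤ (σ n).1⁻¹) := hn
    exact (not_le.1 hn').le
  · classical
    intro i j
    simp only [hu]
    rw [orthonormal_iff_ite.1 he]
    simp [hσ.1.eq_iff]
  · intro i
    simp only [hu, he.1]
  · intro i v
    simp only [hu]
    rw [map_smul, LinearMap.smul_apply, hR, smul_eq_mul]
  · simp only [hu]
    rw [← hspan]
    congr 2
    exact hσ.2.range_comp e
end
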